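/- Let f : ℝ → ℝ be a function that is differentiable on (0,∞), strictly increasing on (0,∞), and concave on (0,∞), and suppose f(x) tends to a limit α as x → ∞. Let x₀ > 0 be a point with f'(x₀) > 0. Then for every x₁ with x₁ - x₀ ≥ (α - f(x₀)) / f'(x₀), the derivative of f at x₁ differs from the derivative of f at x₀, i.e. f'(x₁) ≠ f'(x₀). -/

import Mathlib

/-- A function strictly increasing on a ray stays strictly below its limit at infinity. -/
theorem StrictMonoOn.lt_of_tendsto_atTop {f : ℝ → ℝ} {a α x : ℝ}
    (hf : StrictMonoOn f (Set.Ioi a)) (hlim : Filter.Tendsto f Filter.atTop (nhds α))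
    (hx : a < x) : f x < α := by
  have hx' : a < x + 1 := by linarith
  refine (hf hx hx' (lt_add_one x)).trans_le (ge_of_tendsto hlim ?_)
  filter_upwards [Filter.eventually_ge_atTop (x + 1)] with y hy
  exact hf.monotoneOn hx' (hx'.trans_le hy) hy

theorem adaptive_step_slope_change
    (f : ℝ → ℝ) (α : ℝ)
    (hdiff : DifferentiableOn ℝ f (Set.Ioi (0 : ℝ)))
    (hmono : StrictMonoOn f (Set.Ioi (0 : ℝ)))
    (hconc : ConcaveOn ℝ (Set.Ioi (0 : ℝ)) f)
    (hlim : Filter.Tendsto f Filter.atTop (nhds α))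
    (x₀ : ℝ) (hx₀ : 0 < x₀) (hderiv : 0 < deriv f x₀) :
    ∀ x₁ : ℝ, (α - f x₀) / deriv f x₀ ≤ x₁ - x₀ → deriv f x₁ ≠ deriv f x₀ := by
  intro x₁ hstep heq
  have h₀ : 0 < α - f x₀ := sub_pos.mpr (hmono.lt_of_tendsto_atTop hlim hx₀)
  have hlt : x₀ < x₁ := sub_pos.mp ((div_pos h₀ hderiv).trans_le hstep)
  have hx₁ : 0 < x₁ := hx₀.trans hlt
  have hslope : deriv f x₁ ≤ slope f x₀ x₁ :=
    hconc.deriv_le_slope hx₀ hx₁ hlt (hdiff.differentiableAt (Ioi_mem_nhds hx₁))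
  rw [heq, slope_def_field, le_div_iff₀ (sub_pos.mpr hlt)] at hslope
  rw [div_le_iff₀ hderiv] at hstep
  linarith [hmono.lt_of_tendsto_atTop hlim hx₁]
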